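/- For every n ≥ 3, every convex n-gon P ⊂ ℝ² (a 2-dimensional polytope with exactly n vertices), and every ε > 0, there exists a convex n-gon P' ⊂ ℝ² with all vertex coordinates rational, whose Hausdorff distance to P is less than ε, and such that xc(P') ≥ 2·√(2n − 2) − 1. -/

import Mathlib

open Set

noncomputable section

/-- A polytope: the convex hull of a finite set of points. -/
def IsPolytope {N : ℕ} (P : Set (Fin N → ℝ)) : Prop :=
  ∃ S : Finset (Fin N → ℝ), P = convexHull ℝ (S : Set (Fin N → ℝ))

/-- Dimension of a set: the dimension of its affine hull (with `-1` for the empty set). -/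
def pdim {N : ℕ} (P : Set (Fin N → ℝ)) : ℤ :=
  haveI := Classical.dec P.Nonempty
  if P.Nonempty then (Module.finrank ℝ (affineSpan ℝ P).direction : ℤ) else -1

/-- `F` is a face of `P`: the subset of `P` where some linear functional bounded above on `P`
attains its maximum value.  This includes `∅` and `P` itself. -/
def IsFaceOf {N : ℕ} (F P : Set (Fin N → ℝ)) : Prop :=
  ∃ (c : Fin N → ℝ) (b : ℝ),
    (∀ x ∈ P, ∑ i, c i * x i ≤ b) ∧ F = {x ∈ P | ∑ i, c i * x i = b}

/-- A facet: a face of dimension one less than the polytope. -/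
def IsFacetOf {N : ℕ} (F P : Set (Fin N → ℝ)) : Prop :=
  IsFaceOf F P ∧ pdim F + 1 = pdim P

/-- A ridge: a face of dimension two less than the polytope. -/
def IsRidgeOf {N : ℕ} (F P : Set (Fin N → ℝ)) : Prop :=
  IsFaceOf F P ∧ pdim F + 2 = pdim P

def IsVertexOf {N : ℕ} (v : Fin N → ℝ) (P : Set (Fin N → ℝ)) : Prop :=
  IsFaceOf {v} P

def vertexSet {N : ℕ} (P : Set (Fin N → ℝ)) : Set (Fin N → ℝ) :=
  {v | IsVertexOf v P}

def vertexCount {N : ℕ} (P : Set (Fin N → ℝ)) : ℕ := (vertexSet P).ncard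

def facetCount {N : ℕ} (P : Set (Fin N → ℝ)) : ℕ := {F | IsFacetOf F P}.ncard

/-- Extension complexity: the minimal number of facets of a polytope (in any dimension)
admitting an affine projection onto `P`. -/
def xc {N : ℕ} (P : Set (Fin N → ℝ)) : ℕ :=
  sInf {n | ∃ (e : ℕ) (Q : Set (Fin e → ℝ)) (π : (Fin e → ℝ) →ᵃ[ℝ] (Fin N → ℝ)),
    IsPolytope Q ∧ π '' Q = P ∧ facetCount Q = n}

/-- Combinatorial equivalence: an inclusion-preserving bijection between face lattices. -/
def CombEquiv {M N : ℕ} (P : Set (Fin M → ℝ)) (Q : Set (Fin N → ℝ)) : Prop :=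
  ∃ φ : {F : Set (Fin M → ℝ) // IsFaceOf F P} ≃ {G : Set (Fin N → ℝ) // IsFaceOf G Q},
    ∀ F₁ F₂ : {F : Set (Fin M → ℝ) // IsFaceOf F P},
      F₁.1 ⊆ F₂.1 ↔ (φ F₁).1 ⊆ (φ F₂).1

/-- A full-dimensional `n`-simplex in `ℝ^n` with the origin in its (relative) interior. -/
def simplexF (n : ℕ) : Set (Fin n → ℝ) :=
  convexHull ℝ ((Set.range fun i : Fin n => Pi.single i (1 : ℝ)) ∪ {fun _ => -1})

/-- The Cartesian product `Δ_n × Δ_m`, realized in `ℝ^{n+m}`. -/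
def prodP (n m : ℕ) : Set (Fin (n + m) → ℝ) :=
  {z | ∃ a ∈ simplexF n, ∃ b ∈ simplexF m, z = Fin.append a b}

/-- The direct sum `Δ_n ⊕ Δ_m`, realized in `ℝ^{n+m}`. -/
def sumP (n m : ℕ) : Set (Fin (n + m) → ℝ) :=
  convexHull ℝ (((fun a : Fin n → ℝ => Fin.append a (0 : Fin m → ℝ)) '' simplexF n) ∪
    ((fun b : Fin m → ℝ => Fin.append (0 : Fin n → ℝ) b) '' simplexF m))

/-- The join `A ⋆ B` of two polytopes, realized in `ℝ^{p+q+1}` with the two copies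
placed in skew affine subspaces. -/
def joinP {p q : ℕ} (A : Set (Fin p → ℝ)) (B : Set (Fin q → ℝ)) :
    Set (Fin (p + q + 1) → ℝ) :=
  convexHull ℝ
    (((fun a : Fin p → ℝ =>
        Fin.append (Fin.append a (0 : Fin q → ℝ)) (fun _ : Fin 1 => (0 : ℝ))) '' A) ∪
     ((fun b : Fin q → ℝ =>
        Fin.append (Fin.append (0 : Fin p → ℝ) b) (fun _ : Fin 1 => (1 : ℝ))) '' B))

/-- The canonical `k`-fold iterated pyramid over `X`, realized in `ℝ^{p+k}`. -/
def pyrK {p : ℕ} (k : ℕ) (X : Set (Fin p → ℝ)) : Set (Fin (p + k) → ℝ) :=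
  convexHull ℝ (((fun x : Fin p → ℝ => Fin.append x (0 : Fin k → ℝ)) '' X) ∪
    Set.range (fun j : Fin k => Fin.append (0 : Fin p → ℝ) (Pi.single j (1 : ℝ))))

/-- Transport a subset of `ℝ^a` to `ℝ^b` along a proof that `a = b`. -/
def castSet {a b : ℕ} (h : a = b) (X : Set (Fin a → ℝ)) : Set (Fin b → ℝ) :=
  (fun x : Fin a → ℝ => fun i : Fin b => x (Fin.cast h.symm i)) '' X

/-- Projective equivalence of two subsets of `ℝ^N`: `Q` is the image of `P` under a
projective transformation `x ↦ (A x + b) / (⟨c, x⟩ + δ)` whose associated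
`(N+1) × (N+1)` matrix is invertible and whose denominator is positive on `P`. -/
def ProjEquiv {N : ℕ} (P Q : Set (Fin N → ℝ)) : Prop :=
  ∃ (A : (Fin N → ℝ) →ₗ[ℝ] (Fin N → ℝ)) (b c : Fin N → ℝ) (δ : ℝ),
    Function.Bijective
      (fun z : (Fin N → ℝ) × ℝ => (A z.1 + z.2 • b, (∑ i, c i * z.1 i) + δ * z.2)) ∧
    (∀ x ∈ P, 0 < (∑ i, c i * x i) + δ) ∧
    Q = (fun x : Fin N → ℝ => ((∑ i, c i * x i) + δ)⁻¹ • (A x + b)) '' P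

/-- `P` is a pyramid with base `B`: the convex hull of `B` and a point outside
the affine hull of `B`. -/
def IsPyramidOver {N : ℕ} (P B : Set (Fin N → ℝ)) : Prop :=
  ∃ a : Fin N → ℝ, a ∉ affineSpan ℝ B ∧ P = convexHull ℝ (B ∪ {a})

/-- `P` is a `k`-fold iterated pyramid over `B`. -/
def IsKFoldPyramidOver {N : ℕ} : ℕ → Set (Fin N → ℝ) → Set (Fin N → ℝ) → Prop
  | 0, P, B => P = B
  | k + 1, P, B => ∃ P' : Set (Fin N → ℝ), IsPyramidOver P P' ∧ IsKFoldPyramidOver k P' B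

/-- `P` is a pyramid: the convex hull of one of its facets together with one more vertex. -/
def IsPyramidPolytope {N : ℕ} (P : Set (Fin N → ℝ)) : Prop :=
  ∃ (F : Set (Fin N → ℝ)) (v : Fin N → ℝ),
    IsFacetOf F P ∧ IsVertexOf v P ∧ P = convexHull ℝ (F ∪ {v})

/-- A facet is pyramidal if it contains all vertices of the polytope but one. -/
def IsPyramidalFacet {N : ℕ} (F P : Set (Fin N → ℝ)) : Prop :=
  IsFacetOf F P ∧ ∃ v, IsVertexOf v P ∧ v ∉ F ∧ ∀ w, IsVertexOf w P → w ≠ v → w ∈ F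

/-- The projection `π_d : ℝ^{d+1} → ℝ^d` forgetting the last coordinate. -/
def projFun (d : ℕ) : (Fin (d + 1) → ℝ) → (Fin d → ℝ) :=
  fun x i => x i.castSucc

/-- `c` is an outer normal vector exposing the face `F` of `Q`. -/
def IsOuterNormal {N : ℕ} (Q F : Set (Fin N → ℝ)) (c : Fin N → ℝ) : Prop :=
  ∃ b : ℝ, (∀ x ∈ Q, ∑ i, c i * x i ≤ b) ∧ F = {x ∈ Q | ∑ i, c i * x i = b}

/-- An upper facet: outer normal with positive last coordinate. -/
def IsUpperFacet {d : ℕ} (F Q : Set (Fin (d + 1) → ℝ)) : Prop :=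
  IsFacetOf F Q ∧ ∃ c, IsOuterNormal Q F c ∧ 0 < c (Fin.last d)

/-- A lower facet: outer normal with negative last coordinate. -/
def IsLowerFacet {d : ℕ} (F Q : Set (Fin (d + 1) → ℝ)) : Prop :=
  IsFacetOf F Q ∧ ∃ c, IsOuterNormal Q F c ∧ c (Fin.last d) < 0

/-- A vertical facet: every outer normal has vanishing last coordinate. -/
def IsVerticalFacet {d : ℕ} (F Q : Set (Fin (d + 1) → ℝ)) : Prop :=
  IsFacetOf F Q ∧ ∀ c, IsOuterNormal Q F c → c (Fin.last d) = 0

/-- An equatorial ridge: a ridge that is the intersection of an upper and a lower facet. -/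
def IsEquatorialRidge {d : ℕ} (F Q : Set (Fin (d + 1) → ℝ)) : Prop :=
  IsRidgeOf F Q ∧ ∃ F₁ F₂ : Set (Fin (d + 1) → ℝ),
    IsUpperFacet F₁ Q ∧ IsLowerFacet F₂ Q ∧ F = F₁ ∩ F₂

/-- A face `F` of `Q` is preserved under the projection forgetting the last coordinate. -/
def PreservedFace {d : ℕ} (Q F : Set (Fin (d + 1) → ℝ)) : Prop :=
  IsFaceOf (projFun d '' F) (projFun d '' Q) ∧ projFun d ⁻¹' (projFun d '' F) ∩ Q = F

/-- A face `F` of `Q` is strictly preserved: preserved and of the same dimension as its image. -/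
def StrictlyPreservedFace {d : ℕ} (Q F : Set (Fin (d + 1) → ℝ)) : Prop :=
  PreservedFace Q F ∧ pdim (projFun d '' F) = pdim F

/-- A hexagon: a 2-dimensional polytope with exactly 6 vertices. -/
def IsHexagon {N : ℕ} (P : Set (Fin N → ℝ)) : Prop :=
  IsPolytope P ∧ pdim P = 2 ∧ vertexCount P = 6

/-- Three lines are concurrent: they share a common point, or they are pairwise parallel. -/
def ConcurrentLines {N : ℕ} (L₁ L₂ L₃ : AffineSubspace ℝ (Fin N → ℝ)) : Prop :=
  (∃ x, x ∈ L₁ ∧ x ∈ L₂ ∧ x ∈ L₃) ∨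
    (AffineSubspace.Parallel L₁ L₂ ∧ AffineSubspace.Parallel L₂ L₃ ∧
      AffineSubspace.Parallel L₁ L₃)

/-- A cyclic labeling of the vertices of a hexagon: consecutive points are joined by edges. -/
def CyclicLabeling {N : ℕ} (P : Set (Fin N → ℝ)) (p : Fin 6 → (Fin N → ℝ)) : Prop :=
  Function.Injective p ∧ Set.range p = vertexSet P ∧
    ∀ i : Fin 6, IsFaceOf (segment ℝ (p i) (p (i + 1))) P

/-- A Desarguian hexagon. -/
def Desarguian {N : ℕ} (P : Set (Fin N → ℝ)) : Prop :=
  ∃ p : Fin 6 → (Fin N → ℝ), CyclicLabeling P p ∧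
    ConcurrentLines (affineSpan ℝ {p 0, p 1}) (affineSpan ℝ {p 5, p 2})
      (affineSpan ℝ {p 3, p 4})

/-- A polytope is simplicial if every facet is a simplex. -/
def IsSimplicial {N : ℕ} (P : Set (Fin N → ℝ)) : Prop :=
  ∀ F : Set (Fin N → ℝ), IsFacetOf F P →
    ∃ S : Finset (Fin N → ℝ),
      AffineIndependent ℝ (Subtype.val : {x // x ∈ S} → (Fin N → ℝ)) ∧
      F = convexHull ℝ (S : Set (Fin N → ℝ))

/-- Rational points outside a proper hypersurface are dense. -/
theorem exists_rat_near_aeval_ne_zero {ι : Type*} {G : MvPolynomial ι ℚ}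
    (hG : G ≠ 0) (x : ι → ℝ) {δ : ℝ} (hδ : 0 < δ) :
    ∃ y : ι → ℚ, (∀ i, |(y i : ℝ) - x i| < δ) ∧
      MvPolynomial.aeval (fun i => (y i : ℝ)) G ≠ 0 := by
  have hs : ∀ i, {q : ℚ | |(q : ℝ) - x i| < δ}.Infinite := by
    intro i
    obtain ⟨a, ha1, ha2⟩ := exists_rat_btwn (show x i - δ < x i by linarith)
    obtain ⟨b, hb1, hb2⟩ := exists_rat_btwn (show (x i : ℝ) < x i + δ by linarith)
    have hab : a < b := by exact_mod_cast ha2.trans hb1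
    refine (Set.Ioo_infinite hab).mono ?_
    intro q hq
    have h1 : (a : ℝ) < q := by exact_mod_cast hq.1
    have h2 : (q : ℝ) < b := by exact_mod_cast hq.2
    simp only [Set.mem_ofPred_eq, abs_lt]
    constructor <;> linarith
  by_contra! hcon
  refine hG (MvPolynomial.funext_set _ hs fun y hy => ?_)
  have := hcon y (fun i => hy i (mem_univ i))
  have h2 : MvPolynomial.aeval (fun i => (y i : ℝ)) G
      = ((MvPolynomial.eval y G : ℚ) : ℝ) := by
    have := MvPolynomial.aeval_algebraMap_apply (A := ℚ) ℝ y G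
    exact this
  rw [h2] at this
  rw [map_zero]
  exact_mod_cast this

/-- More rational functions than variables satisfy a common polynomial relation, at every point
where the denominators do not vanish. -/
theorem exists_polynomial_relation {ι : Type} [Fintype ι] {m : ℕ} (hm : m < Fintype.card ι)
    (N D : ι → MvPolynomial (Fin m) ℚ) :
    ∃ G : MvPolynomial ι ℚ, G ≠ 0 ∧ ∀ (t : Fin m → ℝ) (x : ι → ℝ),
      (∀ i, MvPolynomial.aeval t (D i) ≠ 0) →
      (∀ i, x i * MvPolynomial.aeval t (D i) = MvPolynomial.aeval t (N i)) →
      MvPolynomial.aeval x G = 0 := by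
  classical
  by_cases hD : ∏ i, D i = 0
  · obtain ⟨i, -, hi⟩ := Finset.prod_eq_zero_iff.1 hD
    exact ⟨1, one_ne_zero, fun t x h _ => absurd (by simp [hi]) (h i)⟩
  let L := Localization.Away (∏ i, D i)
  have hinj : Function.Injective (algebraMap (MvPolynomial (Fin m) ℚ) L) :=
    IsLocalization.injective L (powers_le_nonZeroDivisors_of_noZeroDivisors hD)
  have hunit : ∀ i, IsUnit (algebraMap (MvPolynomial (Fin m) ℚ) L (D i)) := by
    intro i
    refine isUnit_of_dvd_unit (map_dvd _ (Finset.dvd_prod_of_mem D (Finset.mem_univ i)))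
      (IsLocalization.Away.algebraMap_isUnit (S := L) (∏ i, D i))
  let f : ι → L := fun i => algebraMap _ L (N i) * ((hunit i).unit⁻¹ : Lˣ)
  have hdep : ¬ AlgebraicIndependent ℚ f := by
    intro hf
    have h1 := hf.cardinalMk_le_trdeg
    have : IsDomain L := IsLocalization.isDomain_localization
      (powers_le_nonZeroDivisors_of_noZeroDivisors hD)
    have h2 : Algebra.trdeg ℚ L = Algebra.trdeg ℚ (MvPolynomial (Fin m) ℚ) := by
      have : Algebra.IsAlgebraic (MvPolynomial (Fin m) ℚ) L :=
        IsLocalization.isAlgebraic _ (Submonoid.powers (∏ i, D i))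
      have : FaithfulSMul (MvPolynomial (Fin m) ℚ) L :=
        (faithfulSMul_iff_algebraMap_injective _ _).2 hinj
      rw [← trdeg_add_eq ℚ (MvPolynomial (Fin m) ℚ) (A := L),
        trdeg_eq_zero (R := MvPolynomial (Fin m) ℚ) (A := L), add_zero]
    rw [h2, MvPolynomial.trdeg_of_isDomain] at h1
    simp at h1
    omega
  rw [algebraicIndependent_iff] at hdep
  push Not at hdep
  obtain ⟨G, hG0, hG⟩ := hdep
  refine ⟨G, hG, fun t x ht hx => ?_⟩
  have hu : IsUnit ((MvPolynomial.aeval t : MvPolynomial (Fin m) ℚ →ₐ[ℚ] ℝ).toRingHom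
      (∏ i, D i)) := by
    simp [Finset.prod_ne_zero_iff, ht]
  let φ : L →+* ℝ := IsLocalization.Away.lift (S := L) (∏ i, D i) hu
  have hφ : ∀ p, φ (algebraMap _ L p) = MvPolynomial.aeval t p :=
    fun p => IsLocalization.Away.lift_eq _ hu p
  have hfx : ∀ i, φ (f i) = x i := by
    intro i
    have h1 : f i * algebraMap _ L (D i) = algebraMap _ L (N i) := by
      simp [f, mul_assoc]
    have h2 := congrArg φ h1
    rw [map_mul, hφ, hφ, ← hx i] at h2
    exact mul_right_cancel₀ (ht i) h2
  have h3 : MvPolynomial.aeval x G = φ (MvPolynomial.aeval f G) := by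
    rw [MvPolynomial.aeval_def, MvPolynomial.aeval_def, MvPolynomial.hom_eval₂]
    congr 1
    · exact Subsingleton.elim _ _
    · funext i; exact (hfx i).symm
  rw [h3, hG0, map_zero]

/-- The entry of a parametrized matrix: a variable, or one of the constants `0` and `1`. -/
def patternEntry {m : ℕ} : Fin m ⊕ Bool → MvPolynomial (Fin m) ℚ :=
  Sum.elim MvPolynomial.X (fun b => if b then 1 else 0)

theorem exists_pattern {σ : Type*} [Fintype σ] {m : ℕ} (A : σ → ℝ) (Z : Finset σ)
    (hZ : ∀ s ∈ Z, A s = 0 ∨ A s = 1) (hm : Fintype.card σ ≤ m + Z.card) :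
    ∃ (p : σ → Fin m ⊕ Bool) (t : Fin m → ℝ),
      ∀ s, MvPolynomial.aeval t (patternEntry (p s)) = A s := by
  classical
  have hc : Fintype.card {s // s ∉ Z} ≤ Fintype.card (Fin m) := by
    rw [Fintype.card_subtype_compl, Fintype.card_fin, Fintype.card_coe]
    omega
  obtain ⟨f⟩ := Function.Embedding.nonempty_of_card_le hc
  refine ⟨fun s => if h : s ∈ Z then Sum.inr (decide (A s = 1)) else Sum.inl (f ⟨s, h⟩),
    fun i => Function.extend f (fun s => A s) 0 i, fun s => ?_⟩
  by_cases h : s ∈ Z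
  · rcases hZ s h with h0 | h1 <;> simp [patternEntry, *]
  · simp [h, patternEntry, f.injective.extend_apply]

/-- The row index obtained by replacing a blank by the extra row `c`. -/
def rowIndex {k : ℕ} (c : Fin 3) (o : Option (Fin k)) : Fin k ⊕ Fin 3 :=
  o.elim (Sum.inr c) Sum.inl

/-- `G` vanishes at every family of `n` points whose coordinates are quotients of maximal minors of
a `(k + 3) × r` matrix with at most `m` entries different from `0` and `1`. -/
def VanishesOnMinors {n : ℕ} (m k r : ℕ) (G : MvPolynomial (Fin n × Fin 2) ℚ) : Prop :=
  ∀ (A : Fin k ⊕ Fin 3 → Fin r → ℝ) (Z : Finset ((Fin k ⊕ Fin 3) × Fin r)),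
    (∀ s ∈ Z, A s.1 s.2 = 0 ∨ A s.1 s.2 = 1) → (k + 3) * r ≤ m + Z.card →
    ∀ (τ : Fin n → Fin r → Option (Fin k)) (x : Fin n × Fin 2 → ℝ),
    (∀ j, (Matrix.of fun i => A (rowIndex 2 (τ j i))).det ≠ 0) →
    (∀ j c, x (j, c) * (Matrix.of fun i => A (rowIndex 2 (τ j i))).det =
      (Matrix.of fun i => A (rowIndex (Fin.castSucc c) (τ j i))).det) →
    MvPolynomial.aeval x G = 0

theorem exists_polynomial_relation_minors {n m : ℕ} (hm : m < 2 * n) (k r : ℕ) :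
    ∃ G : MvPolynomial (Fin n × Fin 2) ℚ, G ≠ 0 ∧ VanishesOnMinors m k r G := by
  classical
  let M (p : (Fin k ⊕ Fin 3) × Fin r → Fin m ⊕ Bool) (τ : Fin r → Option (Fin k)) (c : Fin 3) :
      Matrix (Fin r) (Fin r) (MvPolynomial (Fin m) ℚ) :=
    Matrix.of fun i l => patternEntry (p (rowIndex c (τ i), l))
  have key : ∀ q : ((Fin k ⊕ Fin 3) × Fin r → Fin m ⊕ Bool) × (Fin n → Fin r → Option (Fin k)),
      ∃ G : MvPolynomial (Fin n × Fin 2) ℚ, G ≠ 0 ∧ ∀ (t : Fin m → ℝ) (x : Fin n × Fin 2 → ℝ),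
      (∀ i : Fin n × Fin 2, MvPolynomial.aeval t (M q.1 (q.2 i.1) 2).det ≠ 0) →
      (∀ i : Fin n × Fin 2, x i * MvPolynomial.aeval t (M q.1 (q.2 i.1) 2).det =
        MvPolynomial.aeval t (M q.1 (q.2 i.1) (Fin.castSucc i.2)).det) →
      MvPolynomial.aeval x G = 0 := fun q =>
    exists_polynomial_relation (by simp; omega) _ _
  choose G hG0 hG using key
  refine ⟨∏ q, G q, Finset.prod_ne_zero_iff.2 fun q _ => hG0 q, ?_⟩
  intro A Z hZ hcard τ x hD hN
  obtain ⟨p, t, hpt⟩ := exists_pattern (m := m) (fun s => A s.1 s.2) Z hZ (by simpa using hcard)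
  have hdet : ∀ j c, MvPolynomial.aeval t (M p (τ j) c).det
      = (Matrix.of fun i => A (rowIndex c (τ j i))).det := by
    intro j c
    rw [AlgHom.map_det]
    congr 1
    ext i l
    simp [M, hpt]
  rw [map_prod]
  refine Finset.prod_eq_zero (Finset.mem_univ (p, τ)) (hG (p, τ) t x ?_ ?_)
  · rintro ⟨j, c⟩
    rw [hdet]; exact hD j
  · rintro ⟨j, c⟩
    rw [hdet, hdet]; exact hN j c

/-- Coordinates of a spanning family, after rescaling the family and choosing a basis among it:
many coordinates are `0` or `1`. -/
theorem exists_normalized_basis {V : Type*} [AddCommGroup V] [Module ℝ V]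
    [FiniteDimensional ℝ V] {k r : ℕ} (hr : Module.finrank ℝ V = r) (ℓ : Fin k → V)
    (hℓ : ∀ i, ℓ i ≠ 0)
    (hspan : Submodule.span ℝ (range ℓ) = ⊤) (u : V) :
    ∃ (b : Module.Basis (Fin r) ℝ V) (c : Fin k → ℝ), (∀ i, c i ≠ 0) ∧
      (∀ l, b.repr u l = 0 ∨ b.repr u l = 1) ∧
      r * r + (k - r) ≤
        (Finset.univ.filter fun s : Fin k × Fin r =>
          b.repr (c s.1 • ℓ s.1) s.2 = 0 ∨ b.repr (c s.1 • ℓ s.1) s.2 = 1).card := by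
  classical
  have hrk : Module.finrank ℝ (Submodule.span ℝ (range ℓ)) = r := by
    rw [hspan, finrank_top, hr]
  obtain ⟨f, hf, hfs, hfi⟩ : ∃ f : Fin r → V, (∀ i, f i ∈ range ℓ) ∧
      Submodule.span ℝ (range f) = ⊤ ∧ LinearIndependent ℝ f := by
    have h := Submodule.exists_fun_fin_finrank_span_eq ℝ (range ℓ)
    rwa [hrk, hspan] at h
  choose a ha using hf
  let b₀ : Module.Basis (Fin r) ℝ V := Module.Basis.mk hfi hfs.ge
  have hb₀ : ∀ i, b₀ i = f i := fun i => by simp [b₀]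
  let w : Fin r → ℝˣ := fun i => if h : b₀.repr u i = 0 then 1 else Units.mk0 _ h
  let b := b₀.unitsSMul w
  have hne : ∀ i, ∃ l, b.repr (ℓ i) l ≠ 0 := by
    intro i
    by_contra! h
    exact hℓ i (b.repr.map_eq_zero_iff.1 (Finsupp.ext h))
  choose d hd using hne
  refine ⟨b, fun i => (b.repr (ℓ i) (d i))⁻¹, fun i => inv_ne_zero (hd i), ?_, ?_⟩
  · intro l
    rw [Module.Basis.repr_unitsSMul]
    by_cases h : b₀.repr u l = 0
    · simp [h]
    · right
      simp [w, h, Units.smul_def]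
  · have hainj : Function.Injective a := by
      intro i j hij
      apply hfi.injective
      rw [← ha, ← ha, hij]
    have hrow : ∀ i l, l ≠ i → b.repr (ℓ (a i)) l = 0 := by
      intro i l hl
      rw [ha, ← hb₀, Module.Basis.repr_unitsSMul]
      simp [hl.symm]
    have hda : ∀ i, d (a i) = i := by
      intro i
      by_contra h
      exact hd (a i) (hrow i _ h)
    let g : (Fin r × Fin r) ⊕ {i // i ∉ range a} → Fin k × Fin r :=
      Sum.elim (fun q => (a q.1, q.2)) (fun i => (i, d i))
    have hg : Function.Injective g := by
      rintro (⟨i, l⟩ | ⟨i, hi⟩) (⟨i', l'⟩ | ⟨i', hi'⟩) h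
      · simp only [g, Sum.elim_inl, Prod.mk.injEq] at h
        rw [hainj h.1, h.2]
      · simp only [g, Sum.elim_inl, Sum.elim_inr, Prod.mk.injEq] at h
        exact absurd ⟨i, h.1⟩ hi'
      · simp only [g, Sum.elim_inl, Sum.elim_inr, Prod.mk.injEq] at h
        exact absurd ⟨i', h.1.symm⟩ hi
      · simp only [g, Sum.elim_inr, Prod.mk.injEq] at h
        simp [h.1]
    have hcard : Fintype.card ((Fin r × Fin r) ⊕ {i // i ∉ range a}) = r * r + (k - r) := by
      rw [Fintype.card_sum, Fintype.card_prod, Fintype.card_fin,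
        Fintype.card_subtype_compl (fun i => i ∈ range a)]
      have : Fintype.card {i // i ∈ range a} = r := by
        rw [← Fintype.card_congr (Equiv.ofInjective a hainj), Fintype.card_fin]
      rw [this, Fintype.card_fin]
    rw [← hcard, ← Finset.card_univ, ← Finset.card_image_of_injective _ hg]
    apply Finset.card_le_card
    intro s hs
    obtain ⟨q, -, rfl⟩ := Finset.mem_image.1 hs
    rw [Finset.mem_filter]
    refine ⟨Finset.mem_univ _, ?_⟩
    rcases q with ⟨i, l⟩ | ⟨i, hi⟩
    · by_cases hl : l = i
      · right
        have := hd (a i)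
        rw [hda] at this
        simp [g, hl, hda, this]
      · left
        simp [g, hrow i l hl]
    · right
      simp [g, hd]

theorem aeval_eq_zero_of_evaluations {n m k r : ℕ} {V : Type*} [AddCommGroup V] [Module ℝ V]
    [FiniteDimensional ℝ V] (hr : Module.finrank ℝ V = r) {G : MvPolynomial (Fin n × Fin 2) ℚ}
    (hG : VanishesOnMinors m k r G)
    (ℓ : Fin k → V) (hℓ : ∀ i, ℓ i ≠ 0) (hspan : Submodule.span ℝ (range ℓ) = ⊤)
    (hm : (k + 3) * r ≤ m + (r + (r * r + (k - r))))
    (T : Fin 3 → V) (ev : Fin n → Module.Dual ℝ V) (x : Fin n × Fin 2 → ℝ)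
    (hT2 : ∀ j, ev j (T 2) = 1) (hT : ∀ j c, ev j (T (Fin.castSucc c)) = x (j, c))
    (hker : ∀ j g, ev j g = 0 → g ∈ Submodule.span ℝ (ℓ '' {i | ev j (ℓ i) = 0})) :
    MvPolynomial.aeval x G = 0 := by
  classical
  obtain ⟨b, c, hc, hu, hcard⟩ := exists_normalized_basis hr ℓ hℓ hspan (T 2)
  let R : Fin k ⊕ Fin 3 → V := Sum.elim (fun i => c i • ℓ i) T
  let A : Fin k ⊕ Fin 3 → Fin r → ℝ := fun o l => b.repr (R o) l
  -- a basis among the second extra row and the rows vanishing at the point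
  have hτ : ∀ j, ∃ τ : Fin r → Option (Fin k),
      LinearIndependent ℝ (fun i => R (rowIndex 2 (τ i))) ∧
      ∀ i, τ i = none ∨ ev j (R (rowIndex 2 (τ i))) = 0 := by
    intro j
    let s : Set (Option (Fin k)) := {o | o = none ∨ ev j (R (rowIndex 2 o)) = 0}
    have hs : Submodule.span ℝ ((fun o => R (rowIndex 2 o)) '' s) = ⊤ := by
      rw [eq_top_iff]
      rintro g -
      have h2 : T 2 ∈ Submodule.span ℝ ((fun o => R (rowIndex 2 o)) '' s) :=
        Submodule.subset_span ⟨none, Or.inl rfl, rfl⟩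
      have h1 : g - ev j g • T 2 ∈ Submodule.span ℝ ((fun o => R (rowIndex 2 o)) '' s) := by
        refine Submodule.span_le.2 ?_ (hker j (g - ev j g • T 2) (by simp [hT2]))
        rintro _ ⟨i, hi, rfl⟩
        have : ℓ i = (c i)⁻¹ • R (rowIndex 2 (some i)) := by
          simp [R, rowIndex, smul_smul, hc i]
        rw [this]
        refine Submodule.smul_mem _ _ (Submodule.subset_span ⟨some i, Or.inr ?_, rfl⟩)
        have hi' : ev j (ℓ i) = 0 := hi
        simp [R, rowIndex, hi']
      simpa using Submodule.add_mem _ h1 (Submodule.smul_mem _ (ev j g) h2)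
    have h := Submodule.exists_fun_fin_finrank_span_eq ℝ ((fun o => R (rowIndex 2 o)) '' s)
    rw [hs, finrank_top, hr] at h
    obtain ⟨f, hf, -, hfi⟩ := h
    choose τ hτs hτf using hf
    refine ⟨τ, ?_, fun i => hτs i⟩
    rwa [show (fun i => R (rowIndex 2 (τ i))) = f from funext hτf]
  choose τ hτi hτ0 using hτ
  let F := Finset.univ.filter fun s : Fin k × Fin r =>
    b.repr (c s.1 • ℓ s.1) s.2 = 0 ∨ b.repr (c s.1 • ℓ s.1) s.2 = 1
  let Z : Finset ((Fin k ⊕ Fin 3) × Fin r) :=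
    Finset.univ.filter fun s => A s.1 s.2 = 0 ∨ A s.1 s.2 = 1
  have hZ : r + F.card ≤ Z.card := by
    let g : Fin r ⊕ {s // s ∈ F} → {s // s ∈ Z} := Sum.elim
      (fun l => ⟨(Sum.inr 2, l), by simpa [Z, A, R] using hu l⟩)
      (fun s => ⟨(Sum.inl s.1.1, s.1.2), by simpa [Z, A, R, F] using s.2⟩)
    have hg : Function.Injective g := by
      rintro (l | ⟨⟨i, l⟩, hs⟩) (l' | ⟨⟨i', l'⟩, hs'⟩) h <;> simp [g] at h ⊢ <;> exact h
    simpa using Fintype.card_le_of_injective g hg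
  have hdet : ∀ j, (Matrix.of fun i => A (rowIndex 2 (τ j i))).det ≠ 0 := by
    intro j
    have hli := (hτi j).map' b.equivFun.toLinearMap (LinearEquiv.ker _)
    have := Matrix.linearIndependent_rows_iff_isUnit.1
      (show LinearIndependent ℝ (Matrix.of fun i => A (rowIndex 2 (τ j i))).row from hli)
    exact ((Matrix.isUnit_iff_isUnit_det _).1 this).ne_zero
  refine hG A Z (fun s hs => (Finset.mem_filter.1 hs).2) ?_ τ x hdet ?_
  · have : r * r + (k - r) ≤ F.card := hcard
    omega
  · intro j q
    have hcard' : Fintype.card (Fin r) = Module.finrank ℝ V := by simp [hr]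
    let β := basisOfLinearIndependentOfCardEqFinrank' _ (hτi j) hcard'
    have hβ : ∀ i, β i = R (rowIndex 2 (τ j i)) := fun i => by simp [β]
    have hexp : ∀ g, g = ∑ i, β.repr g i • R (rowIndex 2 (τ j i)) := by
      intro g
      conv_lhs => rw [← β.sum_repr g]
      simp_rw [hβ]
    have hval : ∀ g, ev j g = ∑ i, β.repr g i * ev j (R (rowIndex 2 (τ j i))) := by
      intro g
      conv_lhs => rw [hexp g]
      simp
    obtain ⟨i₀, hi₀⟩ : ∃ i₀, τ j i₀ = none := by
      by_contra! h
      have h1 := hval (T 2)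
      rw [hT2, Finset.sum_eq_zero] at h1
      · exact one_ne_zero h1
      · intro i _
        rw [(hτ0 j i).resolve_left (h i), mul_zero]
    have huniq : ∀ i, i ≠ i₀ → τ j i ≠ none := by
      intro i hi h
      exact hi ((hτi j).injective (by simp [h, hi₀]))
    have hx : β.repr (T (Fin.castSucc q)) i₀ = x (j, q) := by
      rw [← hT, hval (T (Fin.castSucc q)), Finset.sum_eq_single i₀]
      · simp [hi₀, rowIndex, R, hT2]
      · intro i _ hi
        rw [(hτ0 j i).resolve_left (huniq i hi), mul_zero]
      · simp
    have hup : (Matrix.of fun i => A (rowIndex (Fin.castSucc q) (τ j i))) =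
        (Matrix.of fun i => A (rowIndex 2 (τ j i))).updateRow i₀
          (∑ i, β.repr (T (Fin.castSucc q)) i •
            (Matrix.of fun i => A (rowIndex 2 (τ j i))) i) := by
      ext i l
      by_cases hi : i = i₀
      · subst hi
        rw [Matrix.updateRow_self]
        have := congrArg (fun v => b.repr v l) (hexp (T (Fin.castSucc q)))
        simpa [A, R, hi₀, rowIndex, Finset.sum_apply] using this
      · rw [Matrix.updateRow_ne hi]
        obtain ⟨o, ho⟩ := Option.ne_none_iff_exists'.1 (huniq i hi)
        simp [ho, rowIndex]
    rw [hup, Matrix.det_updateRow_sum, hx, smul_eq_mul]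

theorem exists_sub_smul_vanishing {E : Type*} [AddCommGroup E] [Module ℝ E] {A : Finset E}
    {f g : Module.Dual ℝ E} (hf : ∀ a ∈ A, 0 ≤ f a) (hfg : ∀ a ∈ A, f a = 0 → g a = 0)
    (hg : ∃ a ∈ A, 0 < g a) :
    ∃ s : ℝ, (∀ a ∈ A, 0 ≤ (f - s • g) a) ∧ ∃ a ∈ A, f a ≠ 0 ∧ (f - s • g) a = 0 := by
  classical
  obtain ⟨a₁, ha₁, hga₁⟩ := hg
  obtain ⟨a, ha, hmin⟩ := (A.filter fun a => 0 < g a).exists_min_image (fun a => f a / g a)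
    ⟨a₁, Finset.mem_filter.2 ⟨ha₁, hga₁⟩⟩
  obtain ⟨haA, hga⟩ := Finset.mem_filter.1 ha
  refine ⟨f a / g a, fun x hx => ?_, a, haA, fun h => hga.ne' (hfg a haA h), ?_⟩
  · simp only [LinearMap.sub_apply, LinearMap.smul_apply, smul_eq_mul, sub_nonneg]
    rcases lt_or_ge 0 (g x) with h | h
    · exact (le_div_iff₀ h).1 (hmin x (Finset.mem_filter.2 ⟨hx, h⟩))
    · exact (mul_nonpos_of_nonneg_of_nonpos (div_nonneg (hf a haA) hga.le) h).trans (hf x hx)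
  · simp [hga.ne']

/-- A polyhedral cone of functionals is spanned by the functionals whose zeros span a hyperplane
(and by those vanishing identically). -/
theorem mem_of_nonneg_of_forall_extreme {E : Type*} [AddCommGroup E] [Module ℝ E] (A : Finset E)
    (M : Submodule ℝ (Module.Dual ℝ E)) (h0 : ∀ f : Module.Dual ℝ E, (∀ a ∈ A, f a = 0) → f ∈ M)
    (h1 : ∀ f : Module.Dual ℝ E, (∀ a ∈ A, 0 ≤ f a) →
      Module.finrank ℝ (Submodule.span ℝ {a | a ∈ A ∧ f a = 0}) + 1 =
        Module.finrank ℝ (Submodule.span ℝ (A : Set E)) → f ∈ M)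
    (f : Module.Dual ℝ E) (hf : ∀ a ∈ A, 0 ≤ f a) : f ∈ M := by
  classical
  induction hN : (A.filter fun a => f a ≠ 0).card using Nat.strong_induction_on generalizing f with
  | _ N ih =>
  have step : ∀ g : Module.Dual ℝ E, (∀ a ∈ A, 0 ≤ g a) → (∀ a ∈ A, f a = 0 → g a = 0) →
      (∃ a ∈ A, f a ≠ 0 ∧ g a = 0) → g ∈ M := by
    rintro g hg hfg ⟨a, ha, hfa, hga⟩
    refine ih _ ?_ g hg rfl
    rw [← hN]
    refine Finset.card_lt_card ⟨fun x hx => ?_, fun h => ?_⟩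
    · rw [Finset.mem_filter] at hx ⊢
      exact ⟨hx.1, fun h => hx.2 (hfg x hx.1 h)⟩
    · exact (Finset.mem_filter.1 (h (Finset.mem_filter.2 ⟨ha, hfa⟩))).2 hga
  by_cases hz : ∀ a ∈ A, f a = 0
  · exact h0 f hz
  push Not at hz
  obtain ⟨a₁, ha₁, hfa₁⟩ := hz
  set B : Set E := {a | a ∈ A ∧ f a = 0} with hB
  have hBfin : B.Finite := A.finite_toSet.subset fun a ha => ha.1
  have hBker : Submodule.span ℝ B ≤ LinearMap.ker f := Submodule.span_le.2 fun a ha => ha.2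
  have hBA : Submodule.span ℝ B ≤ Submodule.span ℝ (A : Set E) :=
    Submodule.span_mono fun a ha => ha.1
  have := FiniteDimensional.span_of_finite ℝ hBfin
  have := FiniteDimensional.span_of_finite ℝ A.finite_toSet
  by_cases hW : ∀ a ∈ A, a ∈ Submodule.span ℝ (insert a₁ B)
  · refine h1 f hf (le_antisymm ?_ ?_)
    · refine Submodule.finrank_lt_finrank_of_lt (lt_of_le_of_ne hBA fun h => hfa₁ ?_)
      exact hBker (h ▸ Submodule.subset_span ha₁)
    · have := FiniteDimensional.span_of_finite ℝ (hBfin.insert a₁)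
      refine (Submodule.finrank_mono (Submodule.span_le.2 hW)).trans ?_
      rw [Submodule.span_insert, add_comm]
      refine (Submodule.finrank_add_le_finrank_add_finrank _ _).trans ?_
      gcongr
      exact (finrank_span_le_card ({a₁} : Set E)).trans (by simp)
  push Not at hW
  obtain ⟨a₂, ha₂, ha₂W⟩ := hW
  obtain ⟨g, hg, hWg⟩ : ∃ g : Module.Dual ℝ E, 0 < g a₂ ∧ ∀ a ∈ insert a₁ B, g a = 0 := by
    obtain ⟨g, hg, hWg⟩ := Submodule.exists_le_ker_of_notMem ha₂W
    rcases lt_or_gt_of_ne hg with h | h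
    · exact ⟨-g, by simpa using h, fun a ha => by
        simpa using hWg (Submodule.subset_span ha)⟩
    · exact ⟨g, h, fun a ha => hWg (Submodule.subset_span ha)⟩
  have hfg : ∀ a ∈ A, f a = 0 → g a = 0 := fun a ha h => hWg a (Or.inr ⟨ha, h⟩)
  obtain ⟨s, hs, hs0⟩ := exists_sub_smul_vanishing hf hfg ⟨a₂, ha₂, hg⟩
  have hfg' : ∀ a ∈ A, f a = 0 → (f - s • g) a = 0 := fun a ha h => by simp [h, hfg a ha h]
  have hpos : 0 < (f - s • g) a₁ := by
    simpa [hWg a₁ (mem_insert _ _)] using lt_of_le_of_ne (hf a₁ ha₁) hfa₁.symm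
  obtain ⟨s', hs', hs0'⟩ := exists_sub_smul_vanishing hf hfg' ⟨a₁, ha₁, hpos⟩
  have m₁ : f - s • g ∈ M := step _ hs hfg' hs0
  have m₂ : f - s' • (f - s • g) ∈ M :=
    step _ hs' (fun a ha h => by
      rw [LinearMap.sub_apply, LinearMap.smul_apply, hfg' a ha h, h]; simp) hs0'
  simpa using M.add_mem m₂ (M.smul_mem s' m₁)

theorem face_convexHull_eq {N : ℕ} (S : Finset (Fin N → ℝ)) (f : Module.Dual ℝ (Fin N → ℝ))
    {b : ℝ} (hb : ∀ s ∈ S, f s ≤ b) :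
    {x ∈ convexHull ℝ (S : Set (Fin N → ℝ)) | f x = b} =
      convexHull ℝ (S.filter fun s => f s = b : Set (Fin N → ℝ)) := by
  classical
  ext x
  constructor
  · rintro ⟨hx, hfx⟩
    obtain ⟨w, hw0, hw1, rfl⟩ := Finset.mem_convexHull'.1 hx
    have hsum : ∑ y ∈ S, w y * (b - f y) = 0 := by
      simp only [mul_sub, Finset.sum_sub_distrib, ← Finset.sum_mul, hw1]
      rw [map_sum] at hfx
      simp only [map_smul, smul_eq_mul] at hfx
      rw [hfx]; ring
    have hz := (Finset.sum_eq_zero_iff_of_nonneg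
      (fun y hy => mul_nonneg (hw0 y hy) (sub_nonneg.2 (hb y hy)))).1 hsum
    have hw : ∀ y ∈ S, f y ≠ b → w y = 0 := by
      intro y hy hne
      rcases mul_eq_zero.1 (hz y hy) with h | h
      · exact h
      · exact absurd (sub_eq_zero.1 h).symm hne
    refine Finset.mem_convexHull'.2 ⟨w, fun y hy => hw0 y (Finset.mem_filter.1 hy).1, ?_, ?_⟩
    · rw [← hw1]
      refine Finset.sum_filter_of_ne fun y hy h => ?_
      by_contra hne
      exact h (hw y hy hne)
    · refine Finset.sum_filter_of_ne fun y hy h => ?_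
      by_contra hne
      exact h (by rw [hw y hy hne, zero_smul])
  · intro hx
    refine ⟨convexHull_mono (Finset.coe_subset.2 (Finset.filter_subset _ _)) hx, ?_⟩
    have hc : Convex ℝ {x | f x = b} := convex_hyperplane f.isLinear b
    exact convexHull_min (fun s hs => (Finset.mem_filter.1 hs).2) hc hx

theorem dual_le_of_mem_convexHull {N : ℕ} {S : Set (Fin N → ℝ)} {f : Module.Dual ℝ (Fin N → ℝ)}
    {b : ℝ} (hb : ∀ s ∈ S, f s ≤ b) : ∀ x ∈ convexHull ℝ S, f x ≤ b :=
  convexHull_min hb (convex_halfSpace_le f.isLinear b)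

theorem isFaceOf_iff_exists_dual {N : ℕ} {F P : Set (Fin N → ℝ)} :
    IsFaceOf F P ↔ ∃ (f : Module.Dual ℝ (Fin N → ℝ)) (b : ℝ),
      (∀ x ∈ P, f x ≤ b) ∧ F = {x ∈ P | f x = b} := by
  constructor
  · rintro ⟨c, b, h⟩
    exact ⟨dotProductEquiv ℝ (Fin N) c, b, h⟩
  · rintro ⟨f, b, h⟩
    obtain ⟨c, rfl⟩ := (dotProductEquiv ℝ (Fin N)).surjective f
    exact ⟨c, b, h⟩

theorem mem_of_isVertexOf_convexHull {N : ℕ} {S : Finset (Fin N → ℝ)} {v : Fin N → ℝ}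
    (hv : IsVertexOf v (convexHull ℝ (S : Set (Fin N → ℝ)))) : v ∈ S := by
  obtain ⟨f, b, hb, hF⟩ := isFaceOf_iff_exists_dual.1 hv
  rw [face_convexHull_eq S f fun s hs => hb s (subset_convexHull ℝ _ hs)] at hF
  have hne : (convexHull ℝ (S.filter fun s => f s = b : Set (Fin N → ℝ))).Nonempty :=
    hF ▸ singleton_nonempty v
  obtain ⟨s, hs⟩ := convexHull_nonempty_iff.1 hne
  have : s ∈ ({v} : Set (Fin N → ℝ)) := hF ▸ subset_convexHull ℝ _ hs
  rw [← mem_singleton_iff.1 this]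
  exact (Finset.mem_filter.1 hs).1

theorem isVertexOf_convexHull_of_forall_lt {N : ℕ} {S : Finset (Fin N → ℝ)} {v : Fin N → ℝ}
    (hv : v ∈ S) (f : Module.Dual ℝ (Fin N → ℝ)) (hf : ∀ s ∈ S, s ≠ v → f s < f v) :
    IsVertexOf v (convexHull ℝ (S : Set (Fin N → ℝ))) := by
  have hle : ∀ s ∈ S, f s ≤ f v := fun s hs => by
    by_cases h : s = v
    · rw [h]
    · exact (hf s hs h).le
  refine isFaceOf_iff_exists_dual.2 ⟨f, f v, dual_le_of_mem_convexHull hle, ?_⟩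
  rw [face_convexHull_eq S f hle]
  have : (S.filter fun s => f s = f v) = {v} := by
    ext s
    simp only [Finset.mem_filter, Finset.mem_singleton]
    constructor
    · rintro ⟨hs, h⟩
      by_contra hne
      exact (hf s hs hne).ne h
    · rintro rfl
      exact ⟨hv, rfl⟩
  rw [this]
  simp

/-- A polytope is the convex hull of finitely many points, each of them exposed. -/
theorem IsPolytope.exists_exposed {N : ℕ} {P : Set (Fin N → ℝ)} (hP : IsPolytope P) :
    ∃ S : Finset (Fin N → ℝ), P = convexHull ℝ (S : Set (Fin N → ℝ)) ∧
      ∀ v ∈ S, ∃ f : Module.Dual ℝ (Fin N → ℝ), ∀ s ∈ S, s ≠ v → f s < f v := by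
  classical
  obtain ⟨S, hS, hmin⟩ := WellFounded.has_min
    (InvImage.wf (Finset.card : Finset (Fin N → ℝ) → ℕ) Nat.lt_wfRel.wf)
    {S : Finset (Fin N → ℝ) | P = convexHull ℝ (S : Set (Fin N → ℝ))} hP
  refine ⟨S, hS, fun v hv => ?_⟩
  have hnot : v ∉ convexHull ℝ (S.erase v : Set (Fin N → ℝ)) := by
    intro h
    refine hmin (S.erase v) ?_ (Finset.card_erase_lt_of_mem hv)
    show P = _
    rw [hS]
    refine Subset.antisymm (convexHull_min (fun s hs => ?_) (convex_convexHull ℝ _))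
      (convexHull_mono (by simp))
    by_cases hsv : s = v
    · rw [hsv]; exact h
    · exact subset_convexHull ℝ _ (by simpa using ⟨hs, hsv⟩)
  obtain ⟨f, u, hu, hfu⟩ := geometric_hahn_banach_closed_point (convex_convexHull ℝ _)
    ((Finset.finite_toSet (S.erase v)).isClosed_convexHull (𝕜 := ℝ)) hnot
  exact ⟨f.toLinearMap, fun s hs hsv =>
    (hu s (subset_convexHull ℝ _ (by simpa using ⟨hs, hsv⟩))).trans hfu⟩

theorem vertexSet_convexHull {N : ℕ} {S : Finset (Fin N → ℝ)}
    (hS : ∀ v ∈ S, ∃ f : Module.Dual ℝ (Fin N → ℝ), ∀ s ∈ S, s ≠ v → f s < f v) :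
    vertexSet (convexHull ℝ (S : Set (Fin N → ℝ))) = S := by
  ext v
  refine ⟨fun h => mem_of_isVertexOf_convexHull h, fun h => ?_⟩
  obtain ⟨f, hf⟩ := hS v h
  exact isVertexOf_convexHull_of_forall_lt h f hf

theorem pdim_convexHull {N : ℕ} (S : Set (Fin N → ℝ)) {q : Fin N → ℝ} (hq : q ∈ S) :
    pdim (convexHull ℝ S) = Module.finrank ℝ (Submodule.span ℝ ((fun s => s - q) '' S)) := by
  have hne : (convexHull ℝ S).Nonempty := ⟨q, subset_convexHull ℝ S hq⟩
  rw [pdim, if_pos hne, affineSpan_convexHull, direction_affineSpan,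
    vectorSpan_eq_span_vsub_set_right ℝ hq]
  rfl

theorem finite_setOf_isFacetOf {N : ℕ} {P : Set (Fin N → ℝ)} (hP : IsPolytope P) :
    {F | IsFacetOf F P}.Finite := by
  classical
  obtain ⟨S, rfl⟩ := hP
  refine ((Finset.finite_toSet S.powerset).image
    fun T : Finset (Fin N → ℝ) => convexHull ℝ (T : Set (Fin N → ℝ))).subset ?_
  rintro F ⟨hF, -⟩
  obtain ⟨f, b, hb, rfl⟩ := isFaceOf_iff_exists_dual.1 hF
  exact ⟨S.filter fun s => f s = b,
    Finset.mem_coe.2 (Finset.mem_powerset.2 (Finset.filter_subset _ _)),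
    (face_convexHull_eq S f fun s hs => hb s (subset_convexHull ℝ _ hs)).symm⟩

theorem IsFacetOf.exists_notMem {N : ℕ} {S F : Set (Fin N → ℝ)}
    (hF : IsFacetOf F (convexHull ℝ S)) : ∃ s ∈ S, s ∉ F := by
  by_contra! h
  obtain ⟨f, b, hb, hFe⟩ := isFaceOf_iff_exists_dual.1 hF.1
  have hconv : Convex ℝ F := by
    rw [hFe]
    exact (convex_convexHull ℝ S).inter (convex_hyperplane f.isLinear b)
  have : F = convexHull ℝ S := Subset.antisymm (hFe ▸ fun x hx => hx.1) (convexHull_min h hconv)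
  have h2 := hF.2
  rw [this] at h2
  omega

/-- Every affine function vanishing at a vertex of a polytope agrees there with a linear
combination of functions defining the facets through this vertex. -/
theorem mem_span_facet_functionals {N : ℕ} {S : Finset (Fin N → ℝ)} {q : Fin N → ℝ} (hq : q ∈ S)
    (hexp : ∃ f : Module.Dual ℝ (Fin N → ℝ), ∀ s ∈ S, s ≠ q → f s < f q)
    (c : {F // IsFacetOf F (convexHull ℝ (S : Set (Fin N → ℝ)))} → Module.Dual ℝ (Fin N → ℝ))
    (b : {F // IsFacetOf F (convexHull ℝ (S : Set (Fin N → ℝ)))} → ℝ)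
    (hcb : ∀ F : {F // IsFacetOf F (convexHull ℝ (S : Set (Fin N → ℝ)))},
      F.1 = {x ∈ convexHull ℝ (S : Set (Fin N → ℝ)) | c F x = b F})
    (g : Module.Dual ℝ (Fin N → ℝ)) :
    (fun s : S => g s - g q) ∈ Submodule.span ℝ
      ((fun F (s : S) => b F - c F s) '' {F | b F - c F q = 0}) := by
  classical
  set A : Finset (Fin N → ℝ) := S.image fun s => s - q with hA
  set Nsp := Submodule.span ℝ ((fun F (s : S) => b F - c F s) '' {F | b F - c F q = 0}) with hN
  let Φ : Module.Dual ℝ (Fin N → ℝ) →ₗ[ℝ] (S → ℝ) :=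
    { toFun := fun f s => f s - f q
      map_add' := fun f f' => by ext s; simp; ring
      map_smul' := fun r f => by ext s; simp; ring }
  have hAcoe : (A : Set (Fin N → ℝ)) = (fun s => s - q) '' (S : Set (Fin N → ℝ)) := by
    simp [hA]
  have h0 : ∀ f : Module.Dual ℝ (Fin N → ℝ), (∀ a ∈ A, f a = 0) → Φ f = 0 := by
    intro f hf
    ext s
    have := hf (s - q) (Finset.mem_image_of_mem _ s.2)
    rwa [map_sub] at this
  have hpos : ∀ f : Module.Dual ℝ (Fin N → ℝ), (∀ a ∈ A, 0 ≤ f a) → f ∈ Nsp.comap Φ := by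
    refine mem_of_nonneg_of_forall_extreme A (Nsp.comap Φ)
      (fun f hf => by rw [Submodule.mem_comap, h0 f hf]; exact Nsp.zero_mem) fun f hf hdim => ?_
    have hle : ∀ s ∈ S, (-f) s ≤ -f q := fun s hs => by
      have := hf (s - q) (Finset.mem_image_of_mem _ hs)
      rw [map_sub] at this
      simp only [LinearMap.neg_apply]
      linarith
    have hface := face_convexHull_eq S (-f) hle
    set F : Set (Fin N → ℝ) := {x ∈ convexHull ℝ (S : Set (Fin N → ℝ)) | (-f) x = -f q} with hF
    have hB : (fun s => s - q) '' (S.filter fun s => (-f) s = -f q : Set (Fin N → ℝ)) =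
        {a | a ∈ A ∧ f a = 0} := by
      ext a
      simp only [hA, Finset.mem_image, Set.mem_image, Finset.coe_filter, Set.mem_ofPred_eq,
        LinearMap.neg_apply, neg_inj]
      constructor
      · rintro ⟨s, ⟨hs, h⟩, rfl⟩
        exact ⟨⟨s, hs, rfl⟩, by rw [map_sub, h, sub_self]⟩
      · rintro ⟨⟨s, hs, rfl⟩, h⟩
        exact ⟨s, ⟨hs, by rwa [map_sub, sub_eq_zero] at h⟩, rfl⟩
    have hfacet : IsFacetOf F (convexHull ℝ (S : Set (Fin N → ℝ))) := by
      refine ⟨isFaceOf_iff_exists_dual.2 ⟨-f, -f q, dual_le_of_mem_convexHull hle, rfl⟩, ?_⟩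
      rw [hface, pdim_convexHull _ (show q ∈ _ by simpa using hq), hB,
        pdim_convexHull _ (show q ∈ _ from hq), ← hAcoe]
      exact_mod_cast hdim
    let F' : {F // IsFacetOf F (convexHull ℝ (S : Set (Fin N → ℝ)))} := ⟨F, hfacet⟩
    have hmemF : ∀ s ∈ S, s ∈ F ↔ c F' s = b F' := fun s hs => by
      have := Set.ext_iff.1 (hcb F') s
      rw [show s ∈ F ↔ _ from this]
      exact and_iff_right (subset_convexHull ℝ _ hs)
    have hmemF' : ∀ s ∈ S, s ∈ F ↔ f s = f q := fun s hs => by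
      rw [hF]
      simp only [Set.mem_ofPred_eq, LinearMap.neg_apply, neg_inj]
      exact and_iff_right (subset_convexHull ℝ _ hs)
    have hqF : c F' q = b F' := (hmemF q hq).1 ((hmemF' q hq).2 rfl)
    obtain ⟨s₁, hs₁, hs₁F⟩ := hfacet.exists_notMem
    have hc₁ : c F' (s₁ - q) ≠ 0 := fun h => by
      rw [map_sub, sub_eq_zero, hqF] at h
      exact hs₁F ((hmemF s₁ hs₁).2 h)
    have hcB : ∀ a ∈ {a | a ∈ A ∧ f a = 0}, c F' a = 0 := by
      rintro a ⟨ha, hfa⟩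
      obtain ⟨s, hs, rfl⟩ := Finset.mem_image.1 ha
      rw [map_sub, sub_eq_zero] at hfa ⊢
      rw [hqF]
      exact (hmemF s hs).1 ((hmemF' s hs).2 hfa)
    have hspan : Submodule.span ℝ (insert (s₁ - q) {a | a ∈ A ∧ f a = 0}) =
        Submodule.span ℝ (A : Set (Fin N → ℝ)) := by
      refine Submodule.eq_of_le_of_finrank_le (Submodule.span_mono ?_) ?_
      · exact insert_subset (Finset.mem_image_of_mem _ hs₁) fun a ha => ha.1
      · rw [← hdim]
        refine Submodule.finrank_lt_finrank_of_lt
          (lt_of_le_of_ne (Submodule.span_mono (subset_insert _ _)) fun h => hc₁ ?_)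
        have hker : Submodule.span ℝ {a | a ∈ A ∧ f a = 0} ≤ LinearMap.ker (c F') :=
          Submodule.span_le.2 hcB
        exact hker (h ▸ Submodule.subset_span (mem_insert _ _))
    set r := f (s₁ - q) / c F' (s₁ - q) with hr
    have hvan : Φ (f - r • c F') = 0 := by
      refine h0 _ fun a ha => ?_
      have hker : Submodule.span ℝ (insert (s₁ - q) {a | a ∈ A ∧ f a = 0}) ≤
          LinearMap.ker (f - r • c F') := by
        refine Submodule.span_le.2 ?_
        rintro x (rfl | hx)
        · simp only [SetLike.mem_coe, LinearMap.mem_ker, LinearMap.sub_apply,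
            LinearMap.smul_apply, smul_eq_mul]
          rw [hr, div_mul_cancel₀ _ hc₁, sub_self]
        · simp [hx.2, hcB x hx]
      exact hker (hspan ▸ Submodule.subset_span ha)
    rw [map_sub, map_smul, sub_eq_zero] at hvan
    rw [Submodule.mem_comap, hvan]
    have hΦc : Φ (c F') = -(fun s : S => b F' - c F' s) := by
      ext s
      simp [Φ, hqF]
    rw [hΦc]
    exact Nsp.smul_mem _ (Nsp.neg_mem (Submodule.subset_span ⟨F', by simp [hqF], rfl⟩))
  obtain ⟨f₀, hf₀⟩ := hexp
  have hf₀pos : ∀ a ∈ A, 0 ≤ (-f₀) a ∧ ((-f₀) a = 0 → a = 0) := by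
    intro a ha
    obtain ⟨s, hs, rfl⟩ := Finset.mem_image.1 ha
    by_cases h : s = q
    · simp [h]
    · have := hf₀ s hs h
      simp only [LinearMap.neg_apply, map_sub]
      exact ⟨by linarith, fun h' => by linarith⟩
  -- `-f₀` lies in the interior of the cone
  obtain ⟨t, ht⟩ : ∃ t : ℝ, ∀ a ∈ A, 0 ≤ (g + t • (-f₀)) a := by
    refine ⟨∑ a ∈ A, |g a| / (-f₀) a, fun a ha => ?_⟩
    have hnn : ∀ x ∈ A, 0 ≤ |g x| / (-f₀) x := fun x hx => div_nonneg (abs_nonneg _) (hf₀pos x hx).1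
    have hle := Finset.single_le_sum hnn ha
    rw [LinearMap.add_apply, LinearMap.smul_apply, smul_eq_mul]
    rcases (hf₀pos a ha).1.eq_or_lt with h | h
    · simp [(hf₀pos a ha).2 h.symm]
    · have := (div_le_iff₀ h).1 hle
      have := neg_abs_le (g a)
      linarith
  have hmem := (Nsp.comap Φ).sub_mem (hpos _ ht)
    ((Nsp.comap Φ).smul_mem t (hpos (-f₀) fun a ha => (hf₀pos a ha).1))
  rw [add_sub_cancel_right] at hmem
  exact hmem

theorem exists_affine_coordinate {e N : ℕ} (π : (Fin e → ℝ) →ᵃ[ℝ] (Fin N → ℝ)) (i : Fin N) :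
    ∃ (f : Module.Dual ℝ (Fin e → ℝ)) (b : ℝ), ∀ x, b - f x = π x i := by
  refine ⟨-(LinearMap.proj i ∘ₗ π.linear), π 0 i, fun x => ?_⟩
  have h := congrFun (π.map_vadd 0 x) i
  simp only [vadd_eq_add, add_zero, Pi.add_apply] at h
  simp [h, add_comm]

theorem aeval_eq_zero_of_extension {n m e : ℕ} (hn : 2 ≤ n) {Q : Set (Fin e → ℝ)}
    (hQ : IsPolytope Q) (π : (Fin e → ℝ) →ᵃ[ℝ] (Fin 2 → ℝ)) (x : Fin n → Fin 2 → ℝ)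
    (hx : Function.Injective x) (hv : ∀ j, IsVertexOf (x j) (π '' Q))
    (G : ℕ → MvPolynomial (Fin n × Fin 2) ℚ)
    (hG : ∀ r, VanishesOnMinors m (facetCount Q) r (G r))
    (hm : ∀ r ≤ facetCount Q,
      (facetCount Q + 3) * r ≤ m + (r + (r * r + (facetCount Q - r)))) :
    ∃ r ≤ facetCount Q, MvPolynomial.aeval (fun i => x i.1 i.2) (G r) = 0 := by
  classical
  obtain ⟨S, rfl, hS⟩ := hQ.exists_exposed
  set k := facetCount (convexHull ℝ (S : Set (Fin e → ℝ)))
  have hfin := finite_setOf_isFacetOf hQ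
  have : Finite {F // IsFacetOf F (convexHull ℝ (S : Set (Fin e → ℝ)))} := hfin
  have hcard : Nat.card {F // IsFacetOf F (convexHull ℝ (S : Set (Fin e → ℝ)))} = k :=
    Nat.card_coe_set_eq _
  let φ : Fin k ≃ {F // IsFacetOf F (convexHull ℝ (S : Set (Fin e → ℝ)))} :=
    (Finite.equivFinOfCardEq hcard).symm
  have hface : ∀ F : {F // IsFacetOf F (convexHull ℝ (S : Set (Fin e → ℝ)))}, _ :=
    fun F => isFaceOf_iff_exists_dual.1 F.2.1
  choose c b _ hcb using hface
  have hq : ∀ j, ∃ q : S, π q = x j := by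
    intro j
    have h := hv j
    rw [AffineMap.image_convexHull, ← Finset.coe_image] at h
    obtain ⟨q, hq, hqx⟩ := Finset.mem_image.1 (mem_of_isVertexOf_convexHull h)
    exact ⟨⟨q, hq⟩, hqx⟩
  choose q hq using hq
  -- affine functions restricted to the vertices
  let Ψ : Module.Dual ℝ (Fin e → ℝ) × ℝ →ₗ[ℝ] (S → ℝ) :=
    { toFun := fun p s => p.2 - p.1 s
      map_add' := fun p p' => by ext s; simp; ring
      map_smul' := fun r p => by ext s; simp; ring }
  let V := LinearMap.range Ψ
  let mk : Module.Dual ℝ (Fin e → ℝ) × ℝ → V := fun p => ⟨Ψ p, p, rfl⟩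
  let ℓ : Fin k → V := fun i => mk (c (φ i), b (φ i))
  let ev : S → Module.Dual ℝ V := fun s => LinearMap.proj s ∘ₗ V.subtype
  have hev : ∀ s p, ev s (mk p) = p.2 - p.1 s := fun s p => rfl
  have hker : ∀ s g, ev s g = 0 → g ∈ Submodule.span ℝ (ℓ '' {i | ev s (ℓ i) = 0}) := by
    rintro s ⟨_, ⟨f, r⟩, rfl⟩ hg
    have hg' : r - f s = 0 := hg
    have hmap : Submodule.span ℝ ((fun F (s : S) => b F - c F s) '' {F | b F - c F s = 0}) ≤
        (Submodule.span ℝ (ℓ '' {i | ev s (ℓ i) = 0})).map V.subtype := by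
      refine Submodule.span_le.2 ?_
      rintro _ ⟨F, hF, rfl⟩
      refine ⟨ℓ (φ.symm F), Submodule.subset_span ⟨φ.symm F, ?_, rfl⟩, ?_⟩
      · show b (φ (φ.symm F)) - c (φ (φ.symm F)) s = 0
        rwa [φ.apply_symm_apply]
      · show (fun s : S => b (φ (φ.symm F)) - c (φ (φ.symm F)) s) = _
        rw [φ.apply_symm_apply]
    obtain ⟨g, hgm, hge⟩ := hmap (mem_span_facet_functionals s.2 (hS s s.2) c b hcb (-f))
    convert! hgm using 1
    ext y
    have := congrFun hge y
    rw [Submodule.subtype_apply] at this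
    rw [this]
    show r - f y = (-f) y - (-f) s
    simp only [LinearMap.neg_apply]
    linarith
  have hℓ : ∀ i, ℓ i ≠ 0 := by
    intro i h
    obtain ⟨s, hs, hsF⟩ := (φ i).2.exists_notMem
    have h2 : b (φ i) - c (φ i) s = 0 := congrFun (congrArg Subtype.val h) ⟨s, hs⟩
    exact hsF ((Set.ext_iff.1 (hcb (φ i)) s).2
      ⟨subset_convexHull ℝ _ hs, (sub_eq_zero.1 h2).symm⟩)
  have hspan : Submodule.span ℝ (range ℓ) = ⊤ := by
    have hker' : ∀ s g, ev s g = 0 → g ∈ Submodule.span ℝ (range ℓ) := fun s g hg =>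
      Submodule.span_mono (image_subset_range _ _) (hker s g hg)
    let j₀ : Fin n := ⟨0, by omega⟩
    let j₁ : Fin n := ⟨1, by omega⟩
    have hne : (q j₀ : Fin e → ℝ) ≠ q j₁ := by
      intro h
      have : x j₀ = x j₁ := by rw [← hq, ← hq, h]
      simpa [j₀, j₁] using hx this
    obtain ⟨f, hf⟩ := hS (q j₀) (q j₀).2
    have hf' : f (q j₁) - f (q j₀) ≠ 0 := (sub_neg.2 (hf (q j₁) (q j₁).2 hne.symm)).ne
    set g₀ := mk (f, f (q j₁)) with hg₀
    have hg₀m : g₀ ∈ Submodule.span ℝ (range ℓ) := hker' (q j₁) _ (by rw [hg₀, hev, sub_self])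
    have hg₀e : ev (q j₀) g₀ ≠ 0 := by rw [hg₀, hev]; exact hf'
    rw [eq_top_iff]
    rintro g -
    have h := hker' (q j₀) (g - (ev (q j₀) g / ev (q j₀) g₀) • g₀) (by
      rw [map_sub, map_smul, smul_eq_mul, div_mul_cancel₀ _ hg₀e, sub_self])
    simpa using Submodule.add_mem _ h
      (Submodule.smul_mem _ (ev (q j₀) g / ev (q j₀) g₀) hg₀m)
  have hrk : Module.finrank ℝ V ≤ k := by
    have := finrank_range_le_card (R := ℝ) ℓ
    rwa [Set.finrank, hspan, finrank_top, Fintype.card_fin] at this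
  choose f r hfr using exists_affine_coordinate π
  refine ⟨Module.finrank ℝ V, hrk, aeval_eq_zero_of_evaluations rfl (hG _) ℓ hℓ hspan (hm _ hrk)
    (Fin.snoc (fun i => mk (f i, r i)) (mk (0, 1))) (fun j => ev (q j)) _ ?_ ?_
    fun j => hker (q j)⟩
  · intro j
    rw [show (2 : Fin 3) = Fin.last 2 from rfl, Fin.snoc_last, hev]
    simp
  · intro j i
    rw [Fin.snoc_castSucc, hev, hfr, hq]

theorem hausdorffDist_convexHull_range_le {ι E : Type*} [Nonempty ι] [NormedAddCommGroup E]
    [NormedSpace ℝ E] {x y : ι → E} {δ : ℝ} (h : ∀ i, dist (x i) (y i) ≤ δ) :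
    Metric.hausdorffDist (convexHull ℝ (range x)) (convexHull ℝ (range y)) ≤ δ := by
  have hδ : 0 ≤ δ := dist_nonneg.trans (h (Classical.arbitrary ι))
  have key : ∀ u v : ι → E, (∀ i, dist (u i) (v i) ≤ δ) → ∀ p ∈ convexHull ℝ (range u),
      ∃ p' ∈ convexHull ℝ (range v), dist p p' ≤ δ := by
    intro u v huv p hp
    have hsub : convexHull ℝ (range u) ⊆ {p | ∃ p' ∈ convexHull ℝ (range v), dist p p' ≤ δ} := by
      refine convexHull_min ?_ ?_
      · rintro _ ⟨i, rfl⟩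
        exact ⟨v i, subset_convexHull ℝ _ (mem_range_self i), huv i⟩
      · rintro a ⟨a', ha', haa⟩ b ⟨b', hb', hbb⟩ s t hs ht hst
        refine ⟨s • a' + t • b', convex_convexHull ℝ _ ha' hb' hs ht hst, ?_⟩
        calc dist (s • a + t • b) (s • a' + t • b')
            ≤ dist (s • a) (s • a') + dist (t • b) (t • b') := dist_add_add_le _ _ _ _
          _ = s * dist a a' + t * dist b b' := by
              rw [dist_smul₀, dist_smul₀, Real.norm_of_nonneg hs, Real.norm_of_nonneg ht]
          _ ≤ s * δ + t * δ := by gcongr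
          _ = δ := by rw [← add_mul, hst, one_mul]
    exact hsub hp
  exact Metric.hausdorffDist_le_of_mem_dist hδ (key x y h)
    (key y x fun i => by rw [dist_comm]; exact h i)

theorem exists_isPolytope_extension_facetCount_eq_xc {N : ℕ} {P : Set (Fin N → ℝ)}
    (hP : IsPolytope P) :
    ∃ (e : ℕ) (Q : Set (Fin e → ℝ)) (π : (Fin e → ℝ) →ᵃ[ℝ] (Fin N → ℝ)),
      IsPolytope Q ∧ π '' Q = P ∧ facetCount Q = xc P :=
  Nat.sInf_mem (s := {n | ∃ (e : ℕ) (Q : Set (Fin e → ℝ)) (π : (Fin e → ℝ) →ᵃ[ℝ] (Fin N → ℝ)),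
    IsPolytope Q ∧ π '' Q = P ∧ facetCount Q = n})
    ⟨_, N, P, AffineMap.id ℝ _, hP, by simp, rfl⟩

/-- The orientation determinant of the points with indices `i`, `j`, `l`. -/
def orientation {n : ℕ} (i j l : Fin n) : MvPolynomial (Fin n × Fin 2) ℚ :=
  (.X (j, 0) - .X (i, 0)) * (.X (l, 1) - .X (i, 1)) -
    (.X (j, 1) - .X (i, 1)) * (.X (l, 0) - .X (i, 0))

theorem orientation_ne_zero {n : ℕ} {i j l : Fin n} (hij : i ≠ j) (hil : i ≠ l) (hjl : j ≠ l) :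
    orientation i j l ≠ 0 := by
  intro h
  have := congrArg (MvPolynomial.eval fun s : Fin n × Fin 2 =>
    if s = (j, 0) ∨ s = (l, 1) then (1 : ℚ) else 0) h
  simp [orientation, hij, hil, hjl.symm, hjl] at this

theorem pdim_eq_two_of_orientation {n : ℕ} {y : Fin n → Fin 2 → ℝ} {i j l : Fin n}
    (h : MvPolynomial.aeval (fun s : Fin n × Fin 2 => y s.1 s.2) (orientation i j l) ≠ 0) :
    pdim (convexHull ℝ (range y)) = 2 := by
  rw [pdim_convexHull _ (mem_range_self i)]
  have hdet : (Matrix.of ![y j - y i, y l - y i]).det ≠ 0 := by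
    rw [Matrix.det_fin_two]
    simpa [orientation] using h
  have hli : LinearIndependent ℝ ![y j - y i, y l - y i] :=
    Matrix.linearIndependent_rows_of_det_ne_zero hdet
  have h2 := finrank_span_eq_card hli
  have hle : Submodule.span ℝ (range ![y j - y i, y l - y i]) ≤
      Submodule.span ℝ ((fun s => s - y i) '' range y) := by
    refine Submodule.span_mono ?_
    rintro _ ⟨a, rfl⟩
    fin_cases a
    · exact ⟨y j, mem_range_self j, rfl⟩
    · exact ⟨y l, mem_range_self l, rfl⟩
  have h3 := Submodule.finrank_mono hle
  have h4 := Submodule.finrank_le (Submodule.span ℝ ((fun s => s - y i) '' range y))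
  simp only [Fintype.card_fin] at h2
  rw [Module.finrank_fin_fun] at h4
  rw [h2] at h3
  exact_mod_cast le_antisymm h4 h3

theorem exists_stable_exposed {n N : ℕ} (x : Fin n → Fin N → ℝ)
    (f : Fin n → Module.Dual ℝ (Fin N → ℝ)) (hf : ∀ j i, i ≠ j → f j (x i) < f j (x j)) :
    ∃ δ > 0, ∀ y : Fin n → Fin N → ℝ, dist y x < δ → ∀ j i, i ≠ j → f j (y i) < f j (y j) := by
  have h : ∀ᶠ y in nhds x, ∀ j i, i ≠ j → f j (y i) < f j (y j) := by
    refine Filter.eventually_all.2 fun j => Filter.eventually_all.2 fun i => ?_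
    by_cases hij : i = j
    · exact Filter.Eventually.of_forall fun y h => absurd hij h
    · have hc : Continuous (f j) := LinearMap.continuous_of_finiteDimensional _
      have hc' : ∀ l, Continuous fun y : Fin n → Fin N → ℝ => f j (y l) :=
        fun l => hc.comp (continuous_apply l)
      filter_upwards [(hc' i).continuousAt.eventually_lt (hc' j).continuousAt (hf j i hij)]
        with y hy _ using hy
  exact Metric.eventually_nhds_iff.1 h

theorem generic_ngon_lower_bound (n : ℕ) (hn : 3 ≤ n) (P : Set (Fin 2 → ℝ))
    (hP : IsPolytope P) (hdP : pdim P = 2) (hv : vertexCount P = n)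
    (ε : ℝ) (hε : 0 < ε) :
    ∃ P' : Set (Fin 2 → ℝ),
      IsPolytope P' ∧ pdim P' = 2 ∧ vertexCount P' = n ∧
      (∀ v ∈ vertexSet P', ∀ i : Fin 2, ∃ q : ℚ, v i = (q : ℝ)) ∧
      Metric.hausdorffDist P P' < ε ∧
      2 * Real.sqrt (2 * (n : ℝ) - 2) - 1 ≤ (xc P' : ℝ) := by
  classical
  obtain ⟨S, rfl, hS⟩ := hP.exists_exposed
  have hScard : S.card = n := by
    rw [← hv, vertexCount, vertexSet_convexHull hS, Set.ncard_coe_finset]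
  let E := (S.equivFinOfCardEq hScard).symm
  let x : Fin n → Fin 2 → ℝ := fun j => E j
  have hxr : range x = S := by
    ext s
    exact ⟨fun ⟨j, hj⟩ => hj ▸ (E j).2, fun hs => ⟨E.symm ⟨s, hs⟩, by simp [x]⟩⟩
  have hxi : Function.Injective x := Subtype.val_injective.comp E.injective
  choose f hf using fun j => hS (x j) (E j).2
  obtain ⟨δ, hδ, hstab⟩ := exists_stable_exposed x f
    fun j i hij => hf j (x i) (E i).2 (hxi.ne hij)
  have hm : 2 * n - 1 < 2 * n := by omega
  choose G hG0 hG using fun k r => exists_polynomial_relation_minors (n := n) hm k r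
  let i₀ : Fin n := ⟨0, by omega⟩
  let i₁ : Fin n := ⟨1, by omega⟩
  let i₂ : Fin n := ⟨2, by omega⟩
  have hne : orientation i₀ i₁ i₂ *
      ∏ k ∈ Finset.range (8 * n), ∏ r ∈ Finset.range (k + 1), G k r ≠ 0 :=
    mul_ne_zero (orientation_ne_zero (by simp [i₀, i₁]) (by simp [i₀, i₂]) (by simp [i₁, i₂]))
      (Finset.prod_ne_zero_iff.2 fun k _ => Finset.prod_ne_zero_iff.2 fun r _ => hG0 k r)
  obtain ⟨z, hz, hzG⟩ := exists_rat_near_aeval_ne_zero hne (fun s => x s.1 s.2)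
    (lt_min hδ (half_pos hε))
  let y : Fin n → Fin 2 → ℝ := fun j c => z (j, c)
  rw [map_mul] at hzG
  have hyx : dist y x < min δ (ε / 2) := by
    refine (dist_pi_lt_iff (lt_min hδ (half_pos hε))).2 fun j =>
      (dist_pi_lt_iff (lt_min hδ (half_pos hε))).2 fun c => ?_
    rw [Real.dist_eq]
    exact hz (j, c)
  have hyexp := hstab y (hyx.trans_le (min_le_left _ _))
  have hyi : Function.Injective y := by
    intro i j hij
    by_contra h
    exact (hyexp j i h).ne (by rw [hij])
  let S' : Finset (Fin 2 → ℝ) := Finset.univ.image y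
  have hS'r : (S' : Set (Fin 2 → ℝ)) = range y := by simp [S']
  have hS' : ∀ v ∈ S', ∃ f : Module.Dual ℝ (Fin 2 → ℝ), ∀ s ∈ S', s ≠ v → f s < f v := by
    intro v hv
    obtain ⟨j, -, rfl⟩ := Finset.mem_image.1 hv
    refine ⟨f j, fun s hs hne => ?_⟩
    obtain ⟨i, -, rfl⟩ := Finset.mem_image.1 hs
    exact hyexp j i fun h => hne (by rw [h])
  have hvert := vertexSet_convexHull hS'
  have hP' : IsPolytope (convexHull ℝ (S' : Set (Fin 2 → ℝ))) := ⟨S', rfl⟩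
  refine ⟨convexHull ℝ (S' : Set (Fin 2 → ℝ)), hP', ?_, ?_, ?_, ?_, ?_⟩
  · rw [hS'r]
    exact pdim_eq_two_of_orientation (left_ne_zero_of_mul hzG)
  · rw [vertexCount, hvert, Set.ncard_coe_finset, Finset.card_image_of_injective _ hyi,
      Finset.card_univ, Fintype.card_fin]
  · rw [hvert]
    intro v hv c
    obtain ⟨j, -, rfl⟩ := Finset.mem_image.1 (Finset.mem_coe.1 hv)
    exact ⟨z (j, c), rfl⟩
  · have : Nonempty (Fin n) := ⟨i₀⟩
    rw [hS'r, ← hxr]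
    refine (hausdorffDist_convexHull_range_le (δ := ε / 2) fun i => ?_).trans_lt (half_lt_self hε)
    rw [dist_comm]
    exact ((dist_le_pi_dist y x i).trans_lt hyx).le.trans (min_le_right _ _)
  · by_contra! hlt
    obtain ⟨e, Q, π, hQ, hπ, hk⟩ := exists_isPolytope_extension_facetCount_eq_xc hP'
    rw [← hk] at hlt
    have hn' : (3 : ℝ) ≤ n := by exact_mod_cast hn
    have hsq : ((facetCount Q : ℝ) + 1) ^ 2 < 8 * n - 8 := by
      have h1 : (facetCount Q : ℝ) + 1 < 2 * √(2 * (n : ℝ) - 2) := by linarith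
      have h2 := Real.sq_sqrt (show (0 : ℝ) ≤ 2 * n - 2 by linarith)
      have h3 : (0 : ℝ) ≤ facetCount Q := by positivity
      nlinarith
    have hsq' : (facetCount Q + 1) ^ 2 + 8 < 8 * n := by
      have : ((facetCount Q : ℝ) + 1) ^ 2 + 8 < 8 * n := by linarith
      exact_mod_cast this
    have hm' : ∀ r ≤ facetCount Q, (facetCount Q + 3) * r ≤
        2 * n - 1 + (r + (r * r + (facetCount Q - r))) := by
      intro r hr
      obtain ⟨d, hd⟩ := Nat.exists_eq_add_of_le hr
      rw [hd] at hsq' ⊢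
      have h1 : r + d - r = d := by omega
      rw [h1]
      obtain ⟨N, hN⟩ : ∃ N, 2 * n = N + 1 := ⟨2 * n - 1, by omega⟩
      have h2 : 2 * n - 1 = N := by omega
      rw [h2]
      have h3 : (r + d + 1) ^ 2 + 8 < 4 * (N + 1) := by omega
      zify at h3 ⊢
      have h4 : 4 * (((r : ℤ) + d + 3) * r) < 4 * (N + (r + (r * r + d)) + 1) := by
        nlinarith [sq_nonneg ((r : ℤ) - d - 3)]
      omega
    obtain ⟨r, hr, hGr⟩ := aeval_eq_zero_of_extension (by omega) hQ π y hyi (fun j => by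
      rw [hπ]
      have : y j ∈ vertexSet (convexHull ℝ (S' : Set (Fin 2 → ℝ))) := by
        rw [hvert, hS'r]; exact mem_range_self j
      exact this) (G (facetCount Q)) (hG (facetCount Q)) hm'
    have hkn : facetCount Q < 8 * n := by nlinarith
    refine right_ne_zero_of_mul hzG ?_
    rw [map_prod]
    refine Finset.prod_eq_zero (Finset.mem_range.2 hkn) ?_
    rw [map_prod]
    exact Finset.prod_eq_zero (Finset.mem_range.2 (Nat.lt_succ_of_le hr)) hGr

end
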